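/- If λ ∈ 𝔫* satisfies (𝔰_λ)² ⊆ ker λ, then for every integer e ≥ 0 the number of irreducible constituents of χ_λ of degree q^e equals the number of irreducible characters of the quotient group S_λ/L_λ of degree (|Gλ ∩ λG|/|Gλ|)·q^e. -/

import Mathlib

open scoped Classical BigOperators ComplexOrder

set_option linter.unusedSectionVars false
set_option linter.unusedVariables false

noncomputable section

namespace IterChar

/-! ### Generic notions for finite groups: inner product, induction, characters -/

/-- The standard inner product `⟨f,h⟩_G = |G|⁻¹ ∑_{x ∈ G} f x * conj (h x)`. -/
def innerG (G : Type) [Group G] (f h : G → ℂ) : ℂ :=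
  (Nat.card G : ℂ)⁻¹ * ∑ᶠ x : G, f x * (starRingEnd ℂ) (h x)

/-- Induction of a function from a subgroup, via the Frobenius formula. -/
def indFun {G : Type} [Group G] (H : Subgroup G) (ψ : ↥H → ℂ) : G → ℂ :=
  fun g => (Nat.card ↥H : ℂ)⁻¹ *
    ∑ᶠ x : G, if h : x * g * x⁻¹ ∈ H then ψ ⟨x * g * x⁻¹, h⟩ else 0

/-- A function `G → ℂ` is a character if it is the trace character of some
finite-dimensional complex representation. -/
def IsCharacter (G : Type) [Group G] (f : G → ℂ) : Prop :=
  ∃ V : FDRep ℂ G, f = FDRep.character V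

/-- The set of irreducible characters of `G`: characters of norm one. -/
def Irr (G : Type) [Group G] : Set (G → ℂ) :=
  {f | IsCharacter G f ∧ innerG G f f = 1}

/-- The set of irreducible constituents of `χ`: irreducible characters with
`⟨χ, ψ⟩_G > 0` (using the complex partial order). -/
def IrrConstituents (G : Type) [Group G] (χ : G → ℂ) : Set (G → ℂ) :=
  {f | f ∈ Irr G ∧ 0 < innerG G χ f}

/-! ### Algebra groups -/

variable {F : Type} [Field F] [Fintype F] {R : Type} [Ring R] [Algebra F R] [Fintype R]

/-- `J` is a nilpotent (non-unital) subalgebra: all products of some fixed length vanish. -/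
def IsNil (J : NonUnitalSubalgebra F R) : Prop :=
  ∃ N : ℕ, ∀ l : List R, (∀ x ∈ l, x ∈ J) → l.length = N → l.prod = 0

/-- The algebra group `G = 1 + J` of a (nilpotent) subalgebra `J ⊆ R`, realized as the
subgroup of units `u` of `R` with `u - 1 ∈ J` (and `u⁻¹ - 1 ∈ J`, which is automatic
when `J` is nilpotent). -/
def algGroup (F : Type) [Field F] [Fintype F] (R : Type) [Ring R] [Algebra F R] [Fintype R]
    (J : NonUnitalSubalgebra F R) : Subgroup Rˣ where
  carrier := {u : Rˣ | ((u : R) - 1 ∈ J) ∧ (((u⁻¹ : Rˣ) : R) - 1 ∈ J)}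
  one_mem' := by
    constructor <;> · simp only [Units.val_one, inv_one, sub_self]; exact J.zero_mem
  mul_mem' := by
    rintro u v ⟨hu1, hu2⟩ ⟨hv1, hv2⟩
    constructor
    · have h : ((u * v : Rˣ) : R) - 1 =
          ((u : R) - 1) * ((v : R) - 1) + ((u : R) - 1) + ((v : R) - 1) := by
        push_cast; noncomm_ring
      rw [h]
      exact add_mem (add_mem (mul_mem hu1 hv1) hu1) hv1
    · have h : (((u * v)⁻¹ : Rˣ) : R) - 1 =
          (((v⁻¹ : Rˣ) : R) - 1) * (((u⁻¹ : Rˣ) : R) - 1) +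
            (((v⁻¹ : Rˣ) : R) - 1) + (((u⁻¹ : Rˣ) : R) - 1) := by
        rw [mul_inv_rev]; push_cast; noncomm_ring
      rw [h]
      exact add_mem (add_mem (mul_mem hv2 hu2) hv2) hu2
  inv_mem' := by
    rintro u ⟨h1, h2⟩
    exact ⟨h2, by simpa using h1⟩

theorem mem_algGroup {J : NonUnitalSubalgebra F R} {u : Rˣ} :
    u ∈ algGroup F R J ↔ ((u : R) - 1 ∈ J) ∧ (((u⁻¹ : Rˣ) : R) - 1 ∈ J) :=
  Iff.rfl

/-- The element `X ∈ J` such that `g = 1 + X`. -/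
def gElt {J : NonUnitalSubalgebra F R} (g : ↥(algGroup F R J)) : ↥J :=
  ⟨((g : Rˣ) : R) - 1, g.2.1⟩

/-- The function `θ_λ(1+X) = θ(λ(X))` on the algebra group `1 + J`. -/
def thetaFn (θ : AddChar F ℂ) (J : NonUnitalSubalgebra F R) (lam : ↥J →ₗ[F] F) :
    ↥(algGroup F R J) → ℂ :=
  fun g => θ (lam (gElt g))

/-- Left multiplication by the group element `g` as a linear endomorphism of `J`. -/
def lmulMap {J : NonUnitalSubalgebra F R} (g : ↥(algGroup F R J)) : ↥J →ₗ[F] ↥J where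
  toFun X := ⟨((g : Rˣ) : R) * (X : R), by
    have h : ((g : Rˣ) : R) * (X : R) = (((g : Rˣ) : R) - 1) * (X : R) + (X : R) := by
      noncomm_ring
    rw [h]; exact add_mem (mul_mem g.2.1 X.2) X.2⟩
  map_add' X Y := by ext; simp [mul_add]
  map_smul' c X := by ext; simp [mul_smul_comm]

/-- Right multiplication by the group element `g` as a linear endomorphism of `J`. -/
def rmulMap {J : NonUnitalSubalgebra F R} (g : ↥(algGroup F R J)) : ↥J →ₗ[F] ↥J where
  toFun X := ⟨(X : R) * ((g : Rˣ) : R), by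
    have h : (X : R) * ((g : Rˣ) : R) = (X : R) * (((g : Rˣ) : R) - 1) + (X : R) := by
      noncomm_ring
    rw [h]; exact add_mem (mul_mem X.2 g.2.1) X.2⟩
  map_add' X Y := by ext; simp [add_mul]
  map_smul' c X := by ext; simp [smul_mul_assoc]

/-- The left action of `G` on the dual space: `(gλ)(X) = λ(g⁻¹ X)`. -/
def leftAct {J : NonUnitalSubalgebra F R} (g : ↥(algGroup F R J)) (lam : ↥J →ₗ[F] F) :
    ↥J →ₗ[F] F :=
  lam.comp (lmulMap g⁻¹)

/-- The right action of `G` on the dual space: `(λg)(X) = λ(X g⁻¹)`. -/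
def rightAct {J : NonUnitalSubalgebra F R} (g : ↥(algGroup F R J)) (lam : ↥J →ₗ[F] F) :
    ↥J →ₗ[F] F :=
  lam.comp (rmulMap g⁻¹)

/-- The coadjoint action of `G` on the dual space: `λ^g(X) = λ(g X g⁻¹)`. -/
def coAct {J : NonUnitalSubalgebra F R} (g : ↥(algGroup F R J)) (lam : ↥J →ₗ[F] F) :
    ↥J →ₗ[F] F :=
  lam.comp ((lmulMap g).comp (rmulMap g⁻¹))

/-- The left orbit `Gλ`. -/
def leftOrbit (J : NonUnitalSubalgebra F R) (lam : ↥J →ₗ[F] F) : Set (↥J →ₗ[F] F) :=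
  Set.range fun g : ↥(algGroup F R J) => leftAct g lam

/-- The right orbit `λG`. -/
def rightOrbit (J : NonUnitalSubalgebra F R) (lam : ↥J →ₗ[F] F) : Set (↥J →ₗ[F] F) :=
  Set.range fun g : ↥(algGroup F R J) => rightAct g lam

/-- The two-sided orbit `GλG`. -/
def twoOrbit (J : NonUnitalSubalgebra F R) (lam : ↥J →ₗ[F] F) : Set (↥J →ₗ[F] F) :=
  {mu | ∃ g h : ↥(algGroup F R J), mu = leftAct g (rightAct h lam)}

/-- The coadjoint orbit `λ^G`. -/
def coOrbit (J : NonUnitalSubalgebra F R) (lam : ↥J →ₗ[F] F) : Set (↥J →ₗ[F] F) :=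
  Set.range fun g : ↥(algGroup F R J) => coAct g lam

/-- The right orbit of `λ` under a subgroup `H` of the algebra group. -/
def rightOrbitUnder (J : NonUnitalSubalgebra F R) (H : Subgroup ↥(algGroup F R J))
    (lam : ↥J →ₗ[F] F) : Set (↥J →ₗ[F] F) :=
  {mu | ∃ s ∈ H, mu = rightAct s lam}

/-- The Kirillov function `ψ_λ = |λ^G|^{-1/2} ∑_{μ ∈ λ^G} θ_μ`. -/
def kirillov (θ : AddChar F ℂ) (J : NonUnitalSubalgebra F R) (lam : ↥J →ₗ[F] F) :
    ↥(algGroup F R J) → ℂ :=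
  fun g => ((Real.sqrt (Nat.card ↥(coOrbit J lam)) : ℂ))⁻¹ *
    ∑ᶠ mu ∈ coOrbit J lam, thetaFn θ J mu g

/-- The supercharacter `χ_λ = (|Gλ|/|GλG|) ∑_{μ ∈ GλG} θ_μ`. -/
def superchar (θ : AddChar F ℂ) (J : NonUnitalSubalgebra F R) (lam : ↥J →ₗ[F] F) :
    ↥(algGroup F R J) → ℂ :=
  fun g => ((Nat.card ↥(leftOrbit J lam) : ℂ) / (Nat.card ↥(twoOrbit J lam) : ℂ)) *
    ∑ᶠ mu ∈ twoOrbit J lam, thetaFn θ J mu g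

/-! ### The subalgebras `𝔩_λ`, `𝔰_λ` and their iterates -/

/-- The extension of `λ : J → F` by zero to all of `R`. -/
def lamE (J : NonUnitalSubalgebra F R) (lam : ↥J →ₗ[F] F) (x : R) : F :=
  if h : x ∈ J then lam ⟨x, h⟩ else 0

theorem lamE_apply (J : NonUnitalSubalgebra F R) (lam : ↥J →ₗ[F] F) {x : R} (hx : x ∈ J) :
    lamE J lam x = lam ⟨x, hx⟩ := dif_pos hx

theorem lamE_zero (J : NonUnitalSubalgebra F R) (lam : ↥J →ₗ[F] F) : lamE J lam 0 = 0 := by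
  rw [lamE_apply J lam J.zero_mem]
  have h : (⟨(0 : R), J.zero_mem⟩ : ↥J) = 0 := Subtype.ext rfl
  rw [h, map_zero]

theorem lamE_add (J : NonUnitalSubalgebra F R) (lam : ↥J →ₗ[F] F) {x y : R}
    (hx : x ∈ J) (hy : y ∈ J) : lamE J lam (x + y) = lamE J lam x + lamE J lam y := by
  rw [lamE, lamE, lamE, dif_pos (add_mem hx hy), dif_pos hx, dif_pos hy]
  have h : (⟨x + y, add_mem hx hy⟩ : ↥J) = ⟨x, hx⟩ + ⟨y, hy⟩ := Subtype.ext rfl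
  rw [h, map_add]

theorem lamE_smul (J : NonUnitalSubalgebra F R) (lam : ↥J →ₗ[F] F) (c : F) {x : R}
    (hx : x ∈ J) : lamE J lam (c • x) = c * lamE J lam x := by
  rw [lamE, lamE, dif_pos (SMulMemClass.smul_mem c hx), dif_pos hx]
  have h : (⟨c • x, SMulMemClass.smul_mem c hx⟩ : ↥J) = c • ⟨x, hx⟩ := Subtype.ext rfl
  rw [h, map_smul]
  rfl

/-- The left kernel `𝔩` of the bilinear form `(X,Y) ↦ λ(XY)` restricted to `s × s`. -/
def lStep (J : NonUnitalSubalgebra F R) (lam : ↥J →ₗ[F] F)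
    (s : NonUnitalSubalgebra F R) (hs : s ≤ J) : NonUnitalSubalgebra F R where
  carrier := {x | x ∈ s ∧ ∀ y ∈ s, lamE J lam (x * y) = 0}
  zero_mem' := ⟨zero_mem s, fun y _ => by rw [zero_mul, lamE_zero]⟩
  add_mem' := by
    rintro a b ⟨ha1, ha2⟩ ⟨hb1, hb2⟩
    refine ⟨add_mem ha1 hb1, fun y hy => ?_⟩
    rw [add_mul, lamE_add J lam (J.mul_mem (hs ha1) (hs hy)) (J.mul_mem (hs hb1) (hs hy)),
      ha2 y hy, hb2 y hy, add_zero]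
  smul_mem' := by
    rintro c a ⟨ha1, ha2⟩
    refine ⟨SMulMemClass.smul_mem c ha1, fun y hy => ?_⟩
    rw [smul_mul_assoc, lamE_smul J lam c (J.mul_mem (hs ha1) (hs hy)), ha2 y hy, mul_zero]
  mul_mem' := by
    rintro a b ⟨ha1, ha2⟩ ⟨hb1, hb2⟩
    refine ⟨mul_mem ha1 hb1, fun y hy => ?_⟩
    rw [mul_assoc]
    exact ha2 (b * y) (mul_mem hb1 hy)

theorem lStep_le (J : NonUnitalSubalgebra F R) (lam : ↥J →ₗ[F] F)
    (s : NonUnitalSubalgebra F R) (hs : s ≤ J) : lStep J lam s hs ≤ s :=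
  fun _ hx => hx.1

/-- The left kernel `𝔰` of the bilinear form `(X,Y) ↦ λ(XY)` restricted to `s × 𝔩`. -/
def sStep (J : NonUnitalSubalgebra F R) (lam : ↥J →ₗ[F] F)
    (s : NonUnitalSubalgebra F R) (hs : s ≤ J) : NonUnitalSubalgebra F R where
  carrier := {x | x ∈ s ∧ ∀ y ∈ lStep J lam s hs, lamE J lam (x * y) = 0}
  zero_mem' := ⟨zero_mem s, fun y _ => by rw [zero_mul, lamE_zero]⟩
  add_mem' := by
    rintro a b ⟨ha1, ha2⟩ ⟨hb1, hb2⟩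
    refine ⟨add_mem ha1 hb1, fun y hy => ?_⟩
    rw [add_mul, lamE_add J lam (J.mul_mem (hs ha1) (hs hy.1)) (J.mul_mem (hs hb1) (hs hy.1)),
      ha2 y hy, hb2 y hy, add_zero]
  smul_mem' := by
    rintro c a ⟨ha1, ha2⟩
    refine ⟨SMulMemClass.smul_mem c ha1, fun y hy => ?_⟩
    rw [smul_mul_assoc, lamE_smul J lam c (J.mul_mem (hs ha1) (hs hy.1)), ha2 y hy, mul_zero]
  mul_mem' := by
    rintro a b ⟨ha1, ha2⟩ ⟨hb1, hb2⟩
    refine ⟨mul_mem ha1 hb1, fun y hy => ?_⟩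
    rw [mul_assoc]
    refine ha2 (b * y) ⟨mul_mem hb1 hy.1, fun z hz => ?_⟩
    rw [mul_assoc]
    refine hb2 (y * z) ⟨mul_mem hy.1 hz, fun w hw => ?_⟩
    rw [mul_assoc]
    exact hy.2 (z * w) (mul_mem hz hw)

theorem sStep_le (J : NonUnitalSubalgebra F R) (lam : ↥J →ₗ[F] F)
    (s : NonUnitalSubalgebra F R) (hs : s ≤ J) : sStep J lam s hs ≤ s :=
  fun _ hx => hx.1

/-- `𝔩_λ`: the left kernel of `(X,Y) ↦ λ(XY)` on `J × J`. -/
def lone (J : NonUnitalSubalgebra F R) (lam : ↥J →ₗ[F] F) : NonUnitalSubalgebra F R :=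
  lStep J lam J le_rfl

/-- `𝔰_λ`: the left kernel of `(X,Y) ↦ λ(XY)` on `J × 𝔩_λ`. -/
def sone (J : NonUnitalSubalgebra F R) (lam : ↥J →ₗ[F] F) : NonUnitalSubalgebra F R :=
  sStep J lam J le_rfl

theorem lone_le (J : NonUnitalSubalgebra F R) (lam : ↥J →ₗ[F] F) : lone J lam ≤ J :=
  lStep_le J lam J le_rfl

theorem sone_le (J : NonUnitalSubalgebra F R) (lam : ↥J →ₗ[F] F) : sone J lam ≤ J :=
  sStep_le J lam J le_rfl

/-- `𝔨_λ = 𝔩_λ ∩ ker λ`. -/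
def kone (J : NonUnitalSubalgebra F R) (lam : ↥J →ₗ[F] F) : NonUnitalSubalgebra F R where
  carrier := {x | x ∈ lone J lam ∧ lamE J lam x = 0}
  zero_mem' := ⟨zero_mem _, lamE_zero J lam⟩
  add_mem' := by
    rintro a b ⟨ha1, ha2⟩ ⟨hb1, hb2⟩
    exact ⟨add_mem ha1 hb1, by
      rw [lamE_add J lam (lone_le J lam ha1) (lone_le J lam hb1), ha2, hb2, add_zero]⟩
  smul_mem' := by
    rintro c a ⟨ha1, ha2⟩
    exact ⟨SMulMemClass.smul_mem c ha1, by
      rw [lamE_smul J lam c (lone_le J lam ha1), ha2, mul_zero]⟩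
  mul_mem' := by
    rintro a b ⟨ha1, ha2⟩ ⟨hb1, hb2⟩
    exact ⟨mul_mem ha1 hb1, ha1.2 b (lone_le J lam hb1)⟩

theorem kone_le (J : NonUnitalSubalgebra F R) (lam : ↥J →ₗ[F] F) : kone J lam ≤ lone J lam :=
  fun _ hx => hx.1

/-- The descending chain `𝔰_λ^0 ⊇ 𝔰_λ^1 ⊇ ⋯` (bundled with the proof `𝔰_λ^i ≤ J`). -/
def sChainAux (J : NonUnitalSubalgebra F R) (lam : ↥J →ₗ[F] F) :
    ℕ → {s : NonUnitalSubalgebra F R // s ≤ J}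
  | 0 => ⟨J, le_rfl⟩
  | n + 1 =>
    ⟨sStep J lam (sChainAux J lam n).1 (sChainAux J lam n).2,
      le_trans (sStep_le J lam (sChainAux J lam n).1 (sChainAux J lam n).2)
        (sChainAux J lam n).2⟩

/-- `𝔰_λ^i`. -/
def sChain (J : NonUnitalSubalgebra F R) (lam : ↥J →ₗ[F] F) (i : ℕ) :
    NonUnitalSubalgebra F R :=
  (sChainAux J lam i).1

/-- `𝔩_λ^{i+1}`. -/
def lChain (J : NonUnitalSubalgebra F R) (lam : ↥J →ₗ[F] F) (i : ℕ) :
    NonUnitalSubalgebra F R :=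
  lStep J lam (sChainAux J lam i).1 (sChainAux J lam i).2

/-- The terminal element `𝔰̄_λ` of the descending chain; the chain has stabilized by
stage `|R|` since it is a weakly decreasing chain of subalgebras of the finite algebra. -/
def sbar (J : NonUnitalSubalgebra F R) (lam : ↥J →ₗ[F] F) : NonUnitalSubalgebra F R :=
  sChain J lam (Fintype.card R)

theorem sbar_le (J : NonUnitalSubalgebra F R) (lam : ↥J →ₗ[F] F) : sbar J lam ≤ J :=
  (sChainAux J lam (Fintype.card R)).2

/-- The terminal element `𝔩̄_λ` of the ascending chain. -/
def lbar (J : NonUnitalSubalgebra F R) (lam : ↥J →ₗ[F] F) : NonUnitalSubalgebra F R :=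
  lStep J lam (sbar J lam) (sbar_le J lam)

theorem lbar_le (J : NonUnitalSubalgebra F R) (lam : ↥J →ₗ[F] F) : lbar J lam ≤ J :=
  le_trans (lStep_le J lam _ _) (sbar_le J lam)

/-! ### Algebra subgroups of an algebra group -/

/-- The algebra subgroup `1 + k` of `1 + J`, as a subgroup of the ambient algebra group. -/
def algSubgroup (k J : NonUnitalSubalgebra F R) : Subgroup ↥(algGroup F R J) :=
  (algGroup F R k).subgroupOf (algGroup F R J)

/-- `L_λ = 1 + 𝔩_λ` as a subgroup of `G`. -/
def Lgrp (J : NonUnitalSubalgebra F R) (lam : ↥J →ₗ[F] F) : Subgroup ↥(algGroup F R J) :=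
  algSubgroup (lone J lam) J

/-- `S_λ = 1 + 𝔰_λ` as a subgroup of `G`. -/
def Sgrp (J : NonUnitalSubalgebra F R) (lam : ↥J →ₗ[F] F) : Subgroup ↥(algGroup F R J) :=
  algSubgroup (sone J lam) J

/-- `L̄_λ = 1 + 𝔩̄_λ` as a subgroup of `G`. -/
def Lbarg (J : NonUnitalSubalgebra F R) (lam : ↥J →ₗ[F] F) : Subgroup ↥(algGroup F R J) :=
  algSubgroup (lbar J lam) J

/-- `S̄_λ = 1 + 𝔰̄_λ` as a subgroup of `G`. -/
def Sbarg (J : NonUnitalSubalgebra F R) (lam : ↥J →ₗ[F] F) : Subgroup ↥(algGroup F R J) :=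
  algSubgroup (sbar J lam) J

/-- Passing from an element of the subgroup `1 + k ≤ 1 + J` to an element of the
algebra group `1 + k` in its own right. -/
def toAlg {k J : NonUnitalSubalgebra F R} (x : ↥(algSubgroup k J)) : ↥(algGroup F R k) :=
  ⟨((x : ↥(algGroup F R J)) : Rˣ), Subgroup.mem_subgroupOf.mp x.2⟩

/-- The linear inclusion of a smaller subalgebra. -/
def inclMap {s J : NonUnitalSubalgebra F R} (h : s ≤ J) : ↥s →ₗ[F] ↥J where
  toFun x := ⟨(x : R), h x.2⟩
  map_add' x y := rfl
  map_smul' c x := rfl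

/-- Restriction of a functional on `J` to a smaller subalgebra. -/
def resTo {s J : NonUnitalSubalgebra F R} (h : s ≤ J) (lam : ↥J →ₗ[F] F) : ↥s →ₗ[F] F :=
  lam.comp (inclMap h)

/-- The character `ξ_λ = Ind_{L̄_λ}^G (θ_λ)`. -/
def xi (θ : AddChar F ℂ) (J : NonUnitalSubalgebra F R) (lam : ↥J →ₗ[F] F) :
    ↥(algGroup F R J) → ℂ :=
  indFun (Lbarg J lam) (fun x => thetaFn θ J lam ↑x)

/-- The set `Ξ_λ = {g λ s g⁻¹ : g ∈ G, s ∈ S̄_λ}`. -/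
def Xi (J : NonUnitalSubalgebra F R) (lam : ↥J →ₗ[F] F) : Set (↥J →ₗ[F] F) :=
  {nu | ∃ g : ↥(algGroup F R J), ∃ s ∈ Sbarg J lam, nu = coAct g (rightAct s lam)}

/-! ### Normality of algebra subgroups coming from ideals -/

theorem conj_mem_aux (s a : NonUnitalSubalgebra F R)
    (hl : ∀ x ∈ s, ∀ y ∈ a, x * y ∈ a) (hr : ∀ y ∈ a, ∀ x ∈ s, y * x ∈ a)
    (u : Rˣ) (hu1 : (u : R) - 1 ∈ s) (hu2 : ((u⁻¹ : Rˣ) : R) - 1 ∈ s)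
    (x : Rˣ) (hx : (x : R) - 1 ∈ a) : ((u * x * u⁻¹ : Rˣ) : R) - 1 ∈ a := by
  have h1 : (u : R) * ((u⁻¹ : Rˣ) : R) = 1 := Units.mul_inv u
  have key : ((u * x * u⁻¹ : Rˣ) : R) - 1 =
      ((u : R) - 1) * ((x : R) - 1) * (((u⁻¹ : Rˣ) : R) - 1) +
        ((u : R) - 1) * ((x : R) - 1) + ((x : R) - 1) * (((u⁻¹ : Rˣ) : R) - 1) +
        ((x : R) - 1) := by
    push_cast
    calc (u : R) * (x : R) * ((u⁻¹ : Rˣ) : R) - 1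
        = (u : R) * (x : R) * ((u⁻¹ : Rˣ) : R) - (u : R) * ((u⁻¹ : Rˣ) : R) := by rw [h1]
      _ = _ := by noncomm_ring
  rw [key]
  exact add_mem (add_mem (add_mem (hr _ (hl _ hu1 _ hx) _ hu2) (hl _ hu1 _ hx))
    (hr _ hx _ hu2)) hx

theorem algSubgroup_normal (s a : NonUnitalSubalgebra F R)
    (hl : ∀ x ∈ s, ∀ y ∈ a, x * y ∈ a) (hr : ∀ y ∈ a, ∀ x ∈ s, y * x ∈ a) :
    ((algGroup F R a).subgroupOf (algGroup F R s)).Normal := by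
  constructor
  intro n hn g
  rw [Subgroup.mem_subgroupOf] at hn ⊢
  have hginv : ((g⁻¹ : ↥(algGroup F R s)) : Rˣ) = ((g : Rˣ))⁻¹ := rfl
  have hcoe : ((g * n * g⁻¹ : ↥(algGroup F R s)) : Rˣ) = (g : Rˣ) * (n : Rˣ) * ((g : Rˣ))⁻¹ := by
    push_cast [hginv]; rfl
  rw [mem_algGroup]
  constructor
  · rw [hcoe]
    exact conj_mem_aux s a hl hr (g : Rˣ) (g : ↥(algGroup F R s)).2.1 (g : ↥(algGroup F R s)).2.2
      (n : Rˣ) hn.1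
  · have hinv : (((g * n * g⁻¹ : ↥(algGroup F R s)) : Rˣ))⁻¹ =
        (g : Rˣ) * ((n : Rˣ))⁻¹ * ((g : Rˣ))⁻¹ := by
      rw [hcoe]; group
    rw [hinv]
    exact conj_mem_aux s a hl hr (g : Rˣ) (g : ↥(algGroup F R s)).2.1 (g : ↥(algGroup F R s)).2.2
      ((n : Rˣ))⁻¹ hn.2

theorem lone_mul_mem (J : NonUnitalSubalgebra F R) (lam : ↥J →ₗ[F] F)
    {y z : R} (hy : y ∈ lone J lam) (hz : z ∈ J) : y * z ∈ lone J lam := by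
  refine ⟨J.mul_mem (lone_le J lam hy) hz, fun w hw => ?_⟩
  rw [mul_assoc]
  exact hy.2 (z * w) (J.mul_mem hz hw)

theorem sone_mul_lone_mem (J : NonUnitalSubalgebra F R) (lam : ↥J →ₗ[F] F)
    {x y : R} (hx : x ∈ sone J lam) (hy : y ∈ lone J lam) : x * y ∈ lone J lam := by
  refine ⟨J.mul_mem (sone_le J lam hx) (lone_le J lam hy), fun w hw => ?_⟩
  rw [mul_assoc]
  exact hx.2 (y * w) (lone_mul_mem J lam hy hw)

theorem kone_ideal_left (J : NonUnitalSubalgebra F R) (lam : ↥J →ₗ[F] F) :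
    ∀ x ∈ sone J lam, ∀ y ∈ kone J lam, x * y ∈ kone J lam := by
  intro x hx y hy
  exact ⟨sone_mul_lone_mem J lam hx hy.1, hx.2 y hy.1⟩

theorem kone_ideal_right (J : NonUnitalSubalgebra F R) (lam : ↥J →ₗ[F] F) :
    ∀ y ∈ kone J lam, ∀ x ∈ sone J lam, y * x ∈ kone J lam := by
  intro y hy x hx
  exact ⟨lone_mul_mem J lam hy.1 (sone_le J lam hx), hy.1.2 x (sone_le J lam hx)⟩

/-- `K_λ = 1 + 𝔨_λ` as a (normal) subgroup of `S_λ = 1 + 𝔰_λ`. -/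
def KgrpIn (J : NonUnitalSubalgebra F R) (lam : ↥J →ₗ[F] F) :
    Subgroup ↥(algGroup F R (sone J lam)) :=
  (algGroup F R (kone J lam)).subgroupOf (algGroup F R (sone J lam))

instance KgrpIn_normal (J : NonUnitalSubalgebra F R) (lam : ↥J →ₗ[F] F) :
    (KgrpIn J lam).Normal :=
  algSubgroup_normal (sone J lam) (kone J lam) (kone_ideal_left J lam) (kone_ideal_right J lam)

/-- `L_λ = 1 + 𝔩_λ` as a (normal) subgroup of `S_λ = 1 + 𝔰_λ`. -/
def LgrpIn (J : NonUnitalSubalgebra F R) (lam : ↥J →ₗ[F] F) :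
    Subgroup ↥(algGroup F R (sone J lam)) :=
  (algGroup F R (lone J lam)).subgroupOf (algGroup F R (sone J lam))

instance LgrpIn_normal (J : NonUnitalSubalgebra F R) (lam : ↥J →ₗ[F] F) :
    (LgrpIn J lam).Normal :=
  algSubgroup_normal (sone J lam) (lone J lam)
    (fun x hx y hy => sone_mul_lone_mem J lam hx hy)
    (fun y hy x hx => lone_mul_mem J lam hy (sone_le J lam hx))

/-! ### Closure properties of characters -/

theorem isCharacter_of_rep {G V : Type} [Group G] [AddCommGroup V] [Module ℂ V]
    [FiniteDimensional ℂ V] (ρ : Representation ℂ G V) : IsCharacter G ρ.character :=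
  ⟨FDRep.of ρ, rfl⟩

theorem IsCharacter.exists_rep {G : Type} [Group G] {f : G → ℂ} (hf : IsCharacter G f) :
    ∃ (V : Type) (_ : AddCommGroup V) (_ : Module ℂ V) (_ : FiniteDimensional ℂ V)
      (ρ : Representation ℂ G V), f = ρ.character := by
  obtain ⟨V, rfl⟩ := hf
  exact ⟨V, inferInstance, inferInstance, inferInstance, V.ρ, rfl⟩

theorem IsCharacter.comp {G H : Type} [Group G] [Group H] {f : G → ℂ} (hf : IsCharacter G f)
    (φ : H →* G) : IsCharacter H (fun h => f (φ h)) := by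
  obtain ⟨V, _, _, _, ρ, rfl⟩ := hf.exists_rep
  exact isCharacter_of_rep (ρ.comp φ : Representation ℂ H V)

theorem IsCharacter.mul {G : Type} [Group G] {f h : G → ℂ} (hf : IsCharacter G f)
    (hh : IsCharacter G h) : IsCharacter G (fun g => f g * h g) := by
  obtain ⟨V, _, _, _, ρ, rfl⟩ := hf.exists_rep
  obtain ⟨W, _, _, _, σ, rfl⟩ := hh.exists_rep
  have := isCharacter_of_rep (ρ.tprod σ)
  rwa [Representation.char_tensor] at this

theorem isCharacter_linear {G : Type} [Group G] (τ : G →* ℂˣ) :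
    IsCharacter G (fun g => (τ g : ℂ)) := by
  let ρ : Representation ℂ G ℂ :=
    ((Algebra.lmul ℂ ℂ : ℂ →ₐ[ℂ] Module.End ℂ ℂ) : ℂ →* Module.End ℂ ℂ).comp
      ((Units.coeHom ℂ).comp τ)
  convert isCharacter_of_rep ρ using 1
  funext g
  change _ = LinearMap.trace ℂ ℂ (LinearMap.mul ℂ ℂ (τ g : ℂ))
  rw [LinearMap.trace_eq_matrix_trace ℂ (Module.Basis.singleton Unit ℂ)]
  simp [Matrix.trace, LinearMap.toMatrix_apply]

theorem isCharacter_perm {G X : Type} [Group G] [Fintype X] (φ : G →* Equiv.Perm X) :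
    IsCharacter G (fun g => ∑ x : X, if φ g x = x then (1 : ℂ) else 0) := by
  let ρ : Representation ℂ G (X → ℂ) :=
    { toFun := fun g => LinearMap.funLeft ℂ ℂ (φ g⁻¹)
      map_one' := by ext; simp [LinearMap.funLeft]
      map_mul' := fun a b => by ext; simp [LinearMap.funLeft] }
  convert isCharacter_of_rep ρ using 1
  funext g
  change _ = LinearMap.trace ℂ _ (LinearMap.funLeft ℂ ℂ (φ g⁻¹))
  rw [LinearMap.trace_eq_matrix_trace ℂ (Pi.basisFun ℂ X)]
  refine Finset.sum_congr rfl fun x _ => ?_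
  simp only [Matrix.diag_apply, LinearMap.toMatrix_apply, Pi.basisFun_repr, Pi.basisFun_apply,
    LinearMap.funLeft_apply, Pi.single_apply, map_inv]
  congr 1
  exact propext ⟨fun h => by rw [Equiv.Perm.inv_eq_iff_eq, h], fun h => by
    rw [Equiv.Perm.inv_eq_iff_eq] at h; exact h.symm⟩

/-- The trace of an endomorphism restricted to the image of a projection. -/
theorem trace_eq_of_isProj {V : Type} [AddCommGroup V] [Module ℂ V] [FiniteDimensional ℂ V]
    {p : Submodule ℂ V} {P : V →ₗ[ℂ] V} (hP : LinearMap.IsProj p P) (A : p →ₗ[ℂ] p)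
    (B : V →ₗ[ℂ] V) (hAB : ∀ v : p, (A v : V) = B v) :
    LinearMap.trace ℂ p A = LinearMap.trace ℂ V (B * P) := by
  have h1 : A = (P.codRestrict p hP.map_mem) ∘ₗ (p.subtype ∘ₗ A) := by
    ext v
    simp [hP.map_id _ (A v).2]
  have h2 : B * P = (p.subtype ∘ₗ A) ∘ₗ (P.codRestrict p hP.map_mem) := by
    ext v
    simp [hAB]
  rw [h2, h1, LinearMap.trace_comp_comm' (P.codRestrict p hP.map_mem)]
  congr 1
  ext v
  simp [hP.map_id _ (A _).2]

/-- Averaging a character over the fibres of a surjective homomorphism gives a character. -/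
theorem IsCharacter.push {H Q : Type} [Group H] [Group Q] [Fintype H] {f : H → ℂ}
    (hf : IsCharacter H f) (π : H →* Q) (hπ : Function.Surjective π) :
    IsCharacter Q (fun q => (Nat.card π.ker : ℂ)⁻¹ *
      ∑ h : H, if π h = q then f h else 0) := by
  obtain ⟨V, _, _, _, ρ, rfl⟩ := hf.exists_rep
  have key := (isCharacter_of_rep (ρ.quotientToInvariants π.ker)).comp
    (QuotientGroup.quotientKerEquivOfSurjective π hπ).symm.toMonoidHom
  convert key using 1
  funext q
  obtain ⟨a, rfl⟩ := hπ q
  have ha : (QuotientGroup.quotientKerEquivOfSurjective π hπ).symm.toMonoidHom (π a) =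
      QuotientGroup.mk a :=
    (QuotientGroup.quotientKerEquivOfSurjective π hπ).symm_apply_eq.mpr rfl
  rw [ha]
  let _ : Invertible (Fintype.card π.ker : ℂ) :=
    invertibleOfNonzero (Nat.cast_ne_zero.mpr Fintype.card_ne_zero)
  change _ = LinearMap.trace ℂ _ (ρ.quotientToInvariants π.ker (QuotientGroup.mk a))
  rw [trace_eq_of_isProj (Representation.isProj_averageMap (ρ.comp π.ker.subtype)) _ (ρ a)
    (fun v => rfl)]
  have : ρ a * Representation.averageMap (ρ.comp π.ker.subtype) =
      (Nat.card π.ker : ℂ)⁻¹ • ∑ k : π.ker, ρ (a * k) := by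
    simp [GroupAlgebra.average, map_sum, Finset.mul_sum, invOf_eq_inv]
  rw [this, map_smul, map_sum, smul_eq_mul, ← Finset.sum_filter]
  congr 1
  refine Finset.sum_bij' (fun h hh => ⟨a⁻¹ * h, ?_⟩) (fun k _ => a * k) ?_ ?_ ?_ ?_ ?_
  · simp only [Finset.mem_filter, Finset.mem_univ, true_and] at hh
    simp [MonoidHom.mem_ker, hh]
  · simp
  · intro k _
    have := k.2
    rw [MonoidHom.mem_ker] at this
    simp [this]
  · simp
  · simp
  · intro h _
    simp [Representation.character]

/-! ### Inner products of characters -/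

theorem IsCharacter.map_conj {G : Type} [Group G] {f : G → ℂ} (hf : IsCharacter G f) (x g : G) :
    f (x * g * x⁻¹) = f g := by
  obtain ⟨V, rfl⟩ := hf
  exact V.char_conj g x

theorem IsCharacter.exists_nat_one {G : Type} [Group G] {f : G → ℂ} (hf : IsCharacter G f) :
    ∃ n : ℕ, f 1 = n := by
  obtain ⟨V, rfl⟩ := hf
  exact ⟨_, V.char_one⟩

open Matrix in
theorem IsCharacter.map_inv {G : Type} [Group G] [Fintype G] {f : G → ℂ} (hf : IsCharacter G f)
    (g : G) : f g⁻¹ = (starRingEnd ℂ) (f g) := by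
  obtain ⟨V, _, _, _, ρ, rfl⟩ := hf.exists_rep
  let b := Module.finBasis ℂ V
  let A : G → Matrix _ _ ℂ := fun x => LinearMap.toMatrix b b (ρ x)
  have hA1 : A 1 = 1 := by simp [A]
  have hAm : ∀ x y, A (x * y) = A x * A y := fun x y => by
    simp only [A, map_mul, LinearMap.toMatrix_mul]
  have htr : ∀ x, ρ.character x = (A x).trace := fun x => LinearMap.trace_eq_matrix_trace ℂ b _
  let M := ∑ x : G, (A x)ᴴ * A x
  have hM : IsUnit M := by
    have h1 : M = 1 + ∑ x ∈ Finset.univ.erase (1 : G), (A x)ᴴ * A x := by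
      simp only [M]
      rw [← Finset.add_sum_erase _ _ (Finset.mem_univ (1 : G))]
      simp [hA1]
    rw [h1]
    exact (Matrix.PosDef.one.add_posSemidef (Matrix.posSemidef_sum _ fun x _ =>
      Matrix.posSemidef_conjTranspose_mul_self _)).isUnit
  have hinv : (A g)ᴴ * M = M * A g⁻¹ := by
    have h : (A g)ᴴ * M * A g = M := by
      simp only [M, Finset.mul_sum, Finset.sum_mul]
      refine Fintype.sum_equiv (Equiv.mulRight g) _ _ fun x => ?_
      simp [hAm, Matrix.conjTranspose_mul, Matrix.mul_assoc]
    calc (A g)ᴴ * M = (A g)ᴴ * M * (A g * A g⁻¹) := by rw [← hAm]; simp [hA1]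
      _ = M * A g⁻¹ := by rw [← Matrix.mul_assoc, h]
  obtain ⟨u, hu⟩ := hM
  have hconj : (A g)ᴴ = M * A g⁻¹ * (↑u⁻¹ : Matrix _ _ ℂ) := by
    rw [← hinv, ← hu, Matrix.mul_assoc, Units.mul_inv, Matrix.mul_one]
  rw [htr, htr, starRingEnd_apply, ← Matrix.trace_conjTranspose, hconj, Matrix.trace_mul_comm,
    ← hu, ← Matrix.mul_assoc, Units.inv_mul, Matrix.one_mul]

theorem innerG_eq_sum {G : Type} [Group G] [Fintype G] (f h : G → ℂ) :
    innerG G f h = (Nat.card G : ℂ)⁻¹ * ∑ x : G, f x * (starRingEnd ℂ) (h x) := by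
  rw [innerG, finsum_eq_sum_of_fintype]

theorem IsCharacter.exists_nat_innerG {G : Type} [Group G] [Fintype G] {f h : G → ℂ}
    (hf : IsCharacter G f) (hh : IsCharacter G h) : ∃ n : ℕ, innerG G f h = n := by
  let _ : Invertible (Nat.card G : ℂ) := invertibleOfNonzero (by simp)
  obtain ⟨V, _, _, _, ρ, rfl⟩ := hf.exists_rep
  obtain ⟨W, _, _, _, σ, rfl⟩ := hh.exists_rep
  refine ⟨_, Eq.trans ?_ (Representation.card_inv_mul_sum_char_mul_char_eq_finrank σ ρ)⟩
  simp only [innerG_eq_sum, (isCharacter_of_rep σ).map_inv]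

theorem innerG_conj {G : Type} [Group G] [Fintype G] (f h : G → ℂ) :
    (starRingEnd ℂ) (innerG G f h) = innerG G h f := by
  simp [innerG_eq_sum, mul_comm]

theorem innerG_sub_smul_self {G : Type} [Group G] [Fintype G] (f h : G → ℂ) (n : ℕ) :
    innerG G (fun x => f x - n * h x) (fun x => f x - n * h x) =
      innerG G f f - n * innerG G f h - n * innerG G h f + n * n * innerG G h h := by
  simp only [innerG_eq_sum, map_sub, map_mul, map_natCast, Finset.mul_sum,
    ← Finset.sum_sub_distrib, ← Finset.sum_add_distrib]
  exact Finset.sum_congr rfl fun x _ => by ring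

theorem innerG_self_eq {G : Type} [Group G] [Fintype G] (f : G → ℂ) :
    innerG G f f = (((Nat.card G : ℝ)⁻¹ * ∑ x : G, Complex.normSq (f x) : ℝ) : ℂ) := by
  rw [innerG_eq_sum]
  push_cast
  simp only [Complex.mul_conj]

theorem innerG_self_eq_zero {G : Type} [Group G] [Fintype G] {f : G → ℂ}
    (h : innerG G f f = 0) : f = 0 := by
  rw [innerG_self_eq, Complex.ofReal_eq_zero, mul_eq_zero, or_iff_right (by simp),
    Finset.sum_eq_zero_iff_of_nonneg fun x _ => Complex.normSq_nonneg _] at h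
  funext x
  simpa using h x (Finset.mem_univ x)

theorem innerG_self_re_nonneg {G : Type} [Group G] [Fintype G] (f : G → ℂ) :
    0 ≤ (innerG G f f).re := by
  rw [innerG_self_eq, Complex.ofReal_re]
  exact mul_nonneg (by positivity) (Finset.sum_nonneg fun x _ => Complex.normSq_nonneg _)

/-- If `f` has norm squared `n`, `h` is a unit vector and `⟨f,h⟩ = n` for a positive integer `n`,
then `n = 1` and `f = h`. -/
theorem eq_of_innerG_eq {G : Type} [Group G] [Fintype G] {f h : G → ℂ} {n : ℕ} (hn : n ≠ 0)
    (hff : innerG G f f = n) (hfh : innerG G f h = n) (hhh : innerG G h h = 1) :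
    n = 1 ∧ f = h := by
  have hhf : innerG G h f = n := by rw [← innerG_conj, hfh, map_natCast]
  have key := innerG_sub_smul_self f h n
  rw [hff, hfh, hhf, hhh] at key
  have hre := innerG_self_re_nonneg (fun x => f x - n * h x)
  have key' : innerG G (fun x => f x - n * h x) (fun x => f x - n * h x) =
      ((n - n * n : ℝ) : ℂ) := by
    rw [key]; push_cast; ring
  rw [key', Complex.ofReal_re] at hre
  have h1 : n = 1 := by
    have : n * n ≤ n := by exact_mod_cast sub_nonneg.mp hre
    have : n ≤ 1 := by
      by_contra hc
      push Not at hc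
      nlinarith
    omega
  subst h1
  refine ⟨rfl, ?_⟩
  have h0 := innerG_self_eq_zero (key'.trans (by simp))
  funext x
  simpa [sub_eq_zero] using congrFun h0 x

/-! ### Twisted induction and restriction -/

/-- Induction to `G` of the twist by the linear character `τ` of the inflation to `S` of a function
on `S ⧸ L`. -/
def twistInd {G S : Type} [Group G] [Group S] [Fintype G] [Fintype S] (ι : S →* G)
    (L : Subgroup S) (τ : S →* ℂˣ) (φ : S ⧸ L → ℂ) (g : G) : ℂ :=
  (Nat.card S : ℂ)⁻¹ * ∑ s : S, ∑ x : G, if ι s = x * g * x⁻¹ then (τ s : ℂ) * φ s else 0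

/-- The average over the cosets of `L` of the twist by `τ⁻¹` of the restriction to `S` of a function
on `G`; the adjoint of `twistInd`. -/
def twistRes {G S : Type} [Group G] [Group S] [Fintype S] (ι : S →* G)
    (L : Subgroup S) (τ : S →* ℂˣ) (ψ : G → ℂ) (q : S ⧸ L) : ℂ :=
  (Nat.card L : ℂ)⁻¹ * ∑ s : S, if (s : S ⧸ L) = q then ((τ⁻¹ s : ℂˣ) : ℂ) * ψ (ι s) else 0

/-- The action of `G × S` on `G` with `(g, s)` acting by `x ↦ s x g⁻¹`. -/
def biTranslation {G S : Type} [Group G] [Group S] (ι : S →* G) : G × S →* Equiv.Perm G where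
  toFun p := (Equiv.mulLeft (ι p.2)).trans (Equiv.mulRight p.1⁻¹)
  map_one' := by ext; simp
  map_mul' p p' := by ext; simp [mul_assoc]

section Twist

variable {G S : Type} [Group G] [Group S] [Fintype G] [Fintype S] {ι : S →* G}
  {L : Subgroup S} [L.Normal] {τ : S →* ℂˣ}

theorem star_linear (τ : S →* ℂˣ) (s : S) :
    (starRingEnd ℂ) ((τ⁻¹ s : ℂˣ) : ℂ) = (τ s : ℂ) := by
  have h := (isCharacter_linear τ⁻¹).map_inv s
  rw [← h]
  simp

theorem isCharacter_twistRes {ψ : G → ℂ} (hψ : IsCharacter G ψ) :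
    IsCharacter (S ⧸ L) (twistRes ι L τ ψ) := by
  have := ((isCharacter_linear τ⁻¹).mul (hψ.comp ι)).push (QuotientGroup.mk' L)
    (QuotientGroup.mk'_surjective L)
  rw [QuotientGroup.ker_mk'] at this
  convert this using 2 with q
  simp only [twistRes, QuotientGroup.mk'_apply]
  congr 1
  refine Finset.sum_congr rfl fun s _ => ?_
  by_cases h : (s : S ⧸ L) = q <;> simp [h]

theorem isCharacter_twistInd {φ : S ⧸ L → ℂ} (hφ : IsCharacter (S ⧸ L) φ) :
    IsCharacter G (twistInd ι L τ φ) := by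
  have h1 : IsCharacter S (fun s => (τ s : ℂ) * φ s) :=
    (isCharacter_linear τ).mul (hφ.comp (QuotientGroup.mk' L))
  have h2 := ((isCharacter_perm (biTranslation ι)).mul (h1.comp (MonoidHom.snd G S))).push
    (MonoidHom.fst G S) Prod.fst_surjective
  convert h2 using 1
  funext g
  have hcard : Nat.card (MonoidHom.fst G S).ker = Nat.card S :=
    Nat.card_congr
      { toFun := fun p => p.1.2
        invFun := fun s => ⟨(1, s), rfl⟩
        left_inv := fun p => Subtype.ext (Prod.ext (MonoidHom.mem_ker.mp p.2).symm rfl)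
        right_inv := fun s => rfl }
  rw [hcard, Fintype.sum_prod_type, Finset.sum_comm, twistInd]
  congr 1
  refine Finset.sum_congr rfl fun s _ => ?_
  simp only [MonoidHom.coe_fst, Finset.sum_ite_eq', Finset.mem_univ, if_true, MonoidHom.coe_snd,
    Finset.sum_mul, ite_mul, one_mul, zero_mul]
  refine Finset.sum_congr rfl fun x _ => ?_
  have : biTranslation ι (g, s) x = x ↔ ι s = x * g * x⁻¹ := by
    change ι s * x * g⁻¹ = x ↔ _
    rw [mul_inv_eq_iff_eq_mul, eq_mul_inv_iff_mul_eq]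
  simp only [this]

theorem card_quotient_inv_mul :
    (Nat.card (S ⧸ L) : ℂ)⁻¹ * (Nat.card L : ℂ)⁻¹ = (Nat.card S : ℂ)⁻¹ := by
  rw [L.card_eq_card_quotient_mul_card_subgroup]
  push_cast
  rw [mul_inv]

/-- Frobenius reciprocity. -/
theorem innerG_twistInd (φ : S ⧸ L → ℂ) {ψ : G → ℂ} (hψ : ∀ x g, ψ (x * g * x⁻¹) = ψ g) :
    innerG G (twistInd ι L τ φ) ψ = innerG (S ⧸ L) φ (twistRes ι L τ ψ) := by
  have hG : (Nat.card G : ℂ) ≠ 0 := by simp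
  have lhs : innerG G (twistInd ι L τ φ) ψ =
      (Nat.card S : ℂ)⁻¹ * ∑ s : S, (τ s : ℂ) * φ s * (starRingEnd ℂ) (ψ (ι s)) := by
    rw [innerG_eq_sum]
    simp only [twistInd, mul_assoc, ← Finset.mul_sum, Finset.sum_mul]
    rw [mul_left_comm]
    congr 1
    rw [inv_mul_eq_iff_eq_mul₀ hG, Finset.sum_comm, Finset.mul_sum]
    refine Finset.sum_congr rfl fun s _ => ?_
    rw [Finset.sum_comm]
    have (x : G) : ∑ g : G, (if ι s = x * (g * x⁻¹) then (τ s : ℂ) * φ s else 0) *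
        (starRingEnd ℂ) (ψ g) = (τ s : ℂ) * (φ s * (starRingEnd ℂ) (ψ (ι s))) := by
      rw [Finset.sum_eq_single (x⁻¹ * ι s * x)]
      · rw [if_pos (by group)]
        have := hψ x⁻¹ (ι s)
        rw [inv_inv] at this
        rw [this, mul_assoc]
      · intro g _ hg
        rw [if_neg, zero_mul]
        intro h
        exact hg (by rw [h]; group)
      · simp
    rw [Finset.sum_congr rfl fun x _ => this x, Finset.sum_const, Finset.card_univ, nsmul_eq_mul,
      Nat.card_eq_fintype_card]
  rw [lhs, innerG_eq_sum, ← card_quotient_inv_mul (L := L), mul_assoc]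
  congr 1
  simp only [twistRes, map_mul, map_inv₀, map_natCast, map_sum, apply_ite (starRingEnd ℂ), map_zero,
    star_linear]
  simp only [mul_left_comm (φ _), ← Finset.mul_sum]
  congr 1
  simp only [Finset.mul_sum]
  rw [Finset.sum_comm]
  refine Finset.sum_congr rfl fun s _ => ?_
  rw [Finset.sum_eq_single (s : S ⧸ L)]
  · rw [if_pos rfl]; ring
  · intro q _ hq
    rw [if_neg (Ne.symm hq), mul_zero]
  · simp

theorem sum_coset (q : S ⧸ L) (c : ℂ) :
    ∑ s : S, (if (s : S ⧸ L) = q then c else 0) = Nat.card L * c := by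
  obtain ⟨a, rfl⟩ := QuotientGroup.mk_surjective q
  rw [← Finset.sum_filter, Finset.sum_const, nsmul_eq_mul]
  congr 2
  rw [Nat.card_eq_fintype_card, ← Finset.card_univ]
  refine Finset.card_bij' (fun s hs => ⟨a⁻¹ * s, ?_⟩) (fun l _ => a * l) ?_ ?_ ?_ ?_
  · simp only [Finset.mem_filter, Finset.mem_univ, true_and] at hs
    exact QuotientGroup.eq.mp hs.symm
  all_goals simp

/-- If `τ` restricted to `L` is moved by every element of `G` outside `S`, then `twistInd` is a
section of `twistRes` on class functions. -/
theorem twistRes_twistInd (hι : Function.Injective ι)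
    (hmove : ∀ x ∉ ι.range, ∃ l ∈ L, ∃ l' ∈ L, ι l' = x * ι l * x⁻¹ ∧ τ l ≠ τ l')
    {φ : S ⧸ L → ℂ} (hφ : ∀ x s, φ (x * s * x⁻¹) = φ s) :
    twistRes ι L τ (twistInd ι L τ φ) = φ := by
  funext q
  let T : G → ℂ := fun x => ∑ s : S, ∑ t : S,
    if (s : S ⧸ L) = q ∧ ι t = x * ι s * x⁻¹ then ((τ⁻¹ s : ℂˣ) : ℂ) * (τ t * φ t) else 0
  have hT : twistRes ι L τ (twistInd ι L τ φ) q =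
      (Nat.card L : ℂ)⁻¹ * ((Nat.card S : ℂ)⁻¹ * ∑ x : G, T x) := by
    simp only [twistRes, twistInd, T]
    congr 1
    rw [Finset.sum_comm, Finset.mul_sum]
    refine Finset.sum_congr rfl fun s _ => ?_
    split_ifs with h
    · simp only [h, true_and]
      rw [mul_left_comm, Finset.mul_sum, Finset.sum_comm]
      simp only [Finset.mul_sum, mul_ite, mul_zero]
    · simp [h]
  have hin (u : S) : T (ι u) = Nat.card L * φ q := by
    rw [← sum_coset q (φ q)]
    refine Finset.sum_congr rfl fun s _ => ?_
    rw [Finset.sum_eq_single (u * s * u⁻¹)]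
    · by_cases h : (s : S ⧸ L) = q
      · have h1 : φ ((u * s * u⁻¹ : S) : S ⧸ L) = φ q := by
          rw [QuotientGroup.mk_mul, QuotientGroup.mk_mul, QuotientGroup.mk_inv, hφ, h]
        have h2 : τ (u * s * u⁻¹) = τ s := by
          rw [map_mul, map_mul, map_inv, mul_right_comm, mul_inv_cancel, one_mul]
        rw [if_pos ⟨h, by simp⟩, if_pos h, h1, h2, ← mul_assoc]
        simp
      · simp [h]
    · intro t _ ht
      rw [if_neg]
      rintro ⟨-, h⟩
      exact ht (hι (by simpa using h))
    · simp
  have hout (x : G) (hx : x ∉ ι.range) : T x = 0 := by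
    obtain ⟨l, hl, l', hl', hc, hne⟩ := hmove x hx
    have hTT : T x = ((τ⁻¹ l : ℂˣ) : ℂ) * τ l' * T x := by
      conv_lhs =>
        simp only [T]
        rw [← Equiv.sum_comp (Equiv.mulRight l)]
        enter [2, s]
        rw [← Equiv.sum_comp (Equiv.mulRight l')]
      simp only [T, Finset.mul_sum]
      refine Finset.sum_congr rfl fun s _ => Finset.sum_congr rfl fun t _ => ?_
      have e1 : ((s * l : S) : S ⧸ L) = s := QuotientGroup.mk_mul_of_mem s hl
      have e2 : ((t * l' : S) : S ⧸ L) = t := QuotientGroup.mk_mul_of_mem t hl'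
      have e3 : ι (t * l') = x * ι (s * l) * x⁻¹ ↔ ι t = x * ι s * x⁻¹ := by
        rw [map_mul, map_mul, hc]
        constructor
        · intro h
          apply mul_right_cancel (b := x * ι l * x⁻¹)
          rw [h]; group
        · intro h
          rw [h]; group
      simp only [Equiv.coe_mulRight, e1, e2, e3]
      split_ifs
      · simp only [map_mul, Units.val_mul]
        ring
      · simp
    by_contra h0
    have h1 := mul_right_cancel₀ h0 ((one_mul _).trans hTT)
    rw [← Units.val_mul, eq_comm, Units.val_eq_one, MonoidHom.inv_apply, inv_mul_eq_one] at h1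
    exact hne h1
  have hsum : ∑ x : G, T x = Nat.card S * (Nat.card L * φ q) := by
    rw [← Finset.sum_subset (Finset.subset_univ (Finset.univ.image ι)), Finset.sum_image hι.injOn]
    · simp [hin]
    · intro x _ hx
      exact hout x fun ⟨u, hu⟩ => hx (by simp [← hu])
  rw [hT, hsum, inv_mul_cancel_left₀ (by simp), inv_mul_cancel_left₀ (by simp)]

theorem twistInd_one (hι : Function.Injective ι) (φ : S ⧸ L → ℂ) :
    twistInd ι L τ φ 1 = (Nat.card G : ℂ) / Nat.card S * φ 1 := by
  rw [twistInd, Finset.sum_eq_single 1]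
  · simp only [map_one, mul_one, mul_inv_cancel, if_true, Units.val_one, one_mul, QuotientGroup.mk_one,
      Finset.sum_const, Finset.card_univ, nsmul_eq_mul, Nat.card_eq_fintype_card]
    ring
  · intro s _ hs
    have : ι s ≠ 1 := fun h => hs (hι (h.trans ι.map_one.symm))
    simp [this]
  · simp

/-- Twisted induction is a bijection from the irreducible characters of `S ⧸ L` to the irreducible
characters of `G` that are not annihilated by twisted restriction. -/
theorem card_constituents_eq (hι : Function.Injective ι)
    (hmove : ∀ x ∉ ι.range, ∃ l ∈ L, ∃ l' ∈ L, ι l' = x * ι l * x⁻¹ ∧ τ l ≠ τ l')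
    {χ : G → ℂ} (hχ : ∀ ψ, IsCharacter G ψ →
      innerG G χ ψ = (starRingEnd ℂ) (twistRes ι L τ ψ 1)) (d : ℂ) :
    Nat.card ↥{ψ | ψ ∈ IrrConstituents G χ ∧ ψ 1 = d} =
      Nat.card ↥{φ : S ⧸ L → ℂ | φ ∈ Irr (S ⧸ L) ∧
        φ 1 = (Nat.card S : ℂ) / Nat.card G * d} := by
  have hS : (Nat.card S : ℂ) ≠ 0 := by simp
  have hG : (Nat.card G : ℂ) ≠ 0 := by simp
  have hpos {ψ : G → ℂ} (hψ : IsCharacter G ψ) :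
      0 < innerG G χ ψ ↔ twistRes ι L τ ψ 1 ≠ 0 := by
    obtain ⟨n, hn⟩ := (isCharacter_twistRes (ι := ι) (L := L) (τ := τ) hψ).exists_nat_one
    rw [hχ ψ hψ, hn, map_natCast, Nat.cast_pos, Nat.cast_ne_zero, Nat.pos_iff_ne_zero]
  have hDI {φ : S ⧸ L → ℂ} (hφ : IsCharacter (S ⧸ L) φ) :
      twistRes ι L τ (twistInd ι L τ φ) = φ :=
    twistRes_twistInd hι hmove hφ.map_conj
  have hI {φ : S ⧸ L → ℂ} (hφ : φ ∈ Irr (S ⧸ L)) :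
      twistInd ι L τ φ ∈ IrrConstituents G χ := by
    have hc := isCharacter_twistInd (ι := ι) (τ := τ) hφ.1
    refine ⟨⟨hc, ?_⟩, (hpos hc).mpr ?_⟩
    · rw [innerG_twistInd _ hc.map_conj, hDI hφ.1, hφ.2]
    · rw [hDI hφ.1]
      intro h0
      have hz : φ = 0 := by
        obtain ⟨V, hV⟩ := hφ.1
        have : Module.finrank ℂ V = 0 := by
          rw [hV, FDRep.char_one] at h0
          exact_mod_cast h0
        have : Subsingleton V := Module.finrank_zero_iff.mp this
        funext q
        rw [hV]
        change LinearMap.trace ℂ V (V.ρ q) = 0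
        rw [Subsingleton.elim (V.ρ q) 0, map_zero]
      have h1 := hφ.2
      rw [hz, innerG_eq_sum] at h1
      simp at h1
  have hD {ψ : G → ℂ} (hψ : ψ ∈ IrrConstituents G χ) :
      twistRes ι L τ ψ ∈ Irr (S ⧸ L) ∧ twistInd ι L τ (twistRes ι L τ ψ) = ψ := by
    have hc := isCharacter_twistRes (ι := ι) (L := L) (τ := τ) hψ.1.1
    have hne := (hpos hψ.1.1).mp hψ.2
    obtain ⟨n, hn⟩ := hc.exists_nat_innerG hc
    have hn0 : n ≠ 0 := by
      rintro rfl
      rw [Nat.cast_zero] at hn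
      exact hne (congrFun (innerG_self_eq_zero hn) 1)
    have hc' := isCharacter_twistInd (ι := ι) (τ := τ) hc
    obtain ⟨h1, h2⟩ := eq_of_innerG_eq hn0
      (by rw [innerG_twistInd _ hc'.map_conj, hDI hc, hn])
      (by rw [innerG_twistInd _ hψ.1.1.map_conj, hn]) hψ.1.2
    exact ⟨⟨hc, by rw [hn, h1, Nat.cast_one]⟩, h2⟩
  refine Nat.card_congr
    { toFun := fun ψ => ⟨twistRes ι L τ ψ.1, (hD ψ.2.1).1, ?_⟩
      invFun := fun φ => ⟨twistInd ι L τ φ.1, hI φ.2.1, ?_⟩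
      left_inv := fun ψ => Subtype.ext (hD ψ.2.1).2
      right_inv := fun φ => Subtype.ext (hDI φ.2.1.1) }
  · have h := ψ.2.2
    rw [← (hD ψ.2.1).2, twistInd_one hι] at h
    rw [div_mul_eq_mul_div, div_eq_iff hS] at h
    rw [div_mul_eq_mul_div, eq_div_iff hG, mul_comm, h, mul_comm]
  · rw [twistInd_one hι, φ.2.2]
    field_simp

end Twist

/-! ### Orbit sums -/

/-- A sum over an orbit map, with the orbit points weighted by the size of the stabilizer. -/
theorem sum_orbitMap {A B : Type} [Group A] [Fintype A] (p : A → B)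
    (hp : ∀ c a a', p a = p a' → p (c * a) = p (c * a')) (f : B → ℂ) :
    ∑ a : A, f (p a) =
      (Nat.card {a : A // p a = p 1} : ℂ) * ∑ b ∈ Finset.univ.image p, f b := by
  rw [← Finset.sum_fiberwise_of_maps_to (g := p) (t := Finset.univ.image p) (by simp),
    Finset.mul_sum]
  refine Finset.sum_congr rfl fun b hb => ?_
  obtain ⟨a, -, rfl⟩ := Finset.mem_image.mp hb
  rw [Finset.sum_congr rfl (g := fun _ => f (p a)) (by simp +contextual), Finset.sum_const,
    nsmul_eq_mul, Nat.card_eq_fintype_card, Fintype.card_subtype]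
  congr 2
  refine Finset.card_bij' (fun x _ => a⁻¹ * x) (fun x _ => a * x) ?_ ?_ ?_ ?_
  · intro x hx
    simpa using hp a⁻¹ x a (by simpa using hx)
  · intro x hx
    simpa using hp a x 1 (by simpa using hx)
  all_goals simp

theorem sum_orbitMap_eq_finsum {A B : Type} [Group A] [Fintype A] (p : A → B)
    (hp : ∀ c a a', p a = p a' → p (c * a) = p (c * a')) (f : B → ℂ) :
    ∑ a : A, f (p a) =
      (Nat.card {a : A // p a = p 1} : ℂ) * ∑ᶠ b ∈ Set.range p, f b := by
  rw [sum_orbitMap p hp, ← finsum_mem_coe_finset]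
  simp

theorem card_preimage_orbitMap {A B : Type} [Group A] [Fintype A] (p : A → B)
    (hp : ∀ c a a', p a = p a' → p (c * a) = p (c * a')) (s : Set B) :
    (Nat.card {a : A // p a ∈ s} : ℂ) =
      (Nat.card {a : A // p a = p 1} : ℂ) * (Nat.card ↥(Set.range p ∩ s) : ℂ) := by
  have h := sum_orbitMap p hp (fun b => if b ∈ s then 1 else 0)
  have hset : Set.range p ∩ s = ↑((Finset.univ.image p).filter fun b => b ∈ s) := by
    ext b
    simp
  rw [Finset.sum_boole, Finset.sum_boole] at h
  rw [hset, Nat.card_coe_set_eq, Set.ncard_coe_finset, ← h, Nat.card_eq_fintype_card,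
    Fintype.card_subtype]

theorem card_orbitMap {A B : Type} [Group A] [Fintype A] (p : A → B)
    (hp : ∀ c a a', p a = p a' → p (c * a) = p (c * a')) :
    (Nat.card A : ℂ) =
      (Nat.card {a : A // p a = p 1} : ℂ) * (Nat.card (Set.range p) : ℂ) := by
  have h := card_preimage_orbitMap p hp Set.univ
  rw [Set.inter_univ] at h
  rw [← h, ← Nat.card_congr (Equiv.Set.univ A)]
  rfl

/-! ### Elements of algebra groups -/

section AlgebraGroup

variable {J : NonUnitalSubalgebra F R}

theorem IsNil.isNilpotent (hJ : IsNil J) {x : R} (hx : x ∈ J) : IsNilpotent x := by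
  obtain ⟨N, hN⟩ := hJ
  refine ⟨N, ?_⟩
  rw [← List.prod_replicate]
  exact hN _ (fun y hy => (List.eq_of_mem_replicate hy) ▸ hx) List.length_replicate

theorem inv_sub_one_mem {u : Rˣ} (hu : (u : R) - 1 ∈ J) : ((u⁻¹ : Rˣ) : R) - 1 ∈ J := by
  have hpow : ∀ n : ℕ, ((u ^ n : Rˣ) : R) - 1 ∈ J := by
    intro n
    induction n with
    | zero => simp
    | succ n ih =>
      have : ((u ^ (n + 1) : Rˣ) : R) - 1 =
          (((u ^ n : Rˣ) : R) - 1) * ((u : R) - 1) + (((u ^ n : Rˣ) : R) - 1) + ((u : R) - 1) := by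
        rw [pow_succ, Units.val_mul]
        noncomm_ring
      rw [this]
      exact add_mem (add_mem (mul_mem ih hu) ih) hu
  have : u⁻¹ = u ^ (orderOf u - 1) := by
    rw [inv_eq_iff_mul_eq_one, ← pow_succ', Nat.sub_add_cancel (orderOf_pos u), pow_orderOf_eq_one]
  rw [this]
  exact hpow _

theorem mem_algGroup_iff {u : Rˣ} : u ∈ algGroup F R J ↔ (u : R) - 1 ∈ J :=
  ⟨fun h => h.1, fun h => ⟨h, inv_sub_one_mem h⟩⟩

theorem algGroup_mono {k : NonUnitalSubalgebra F R} (hk : k ≤ J) :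
    algGroup F R k ≤ algGroup F R J :=
  fun _ hu => ⟨hk hu.1, hk hu.2⟩

/-- The element `1 + X` of the algebra group of a nilpotent algebra. -/
def oneAdd (hJ : IsNil J) (X : J) : algGroup F R J :=
  ⟨(hJ.isNilpotent X.2).isUnit_one_add.unit, mem_algGroup_iff.mpr (by simp)⟩

theorem coe_oneAdd (hJ : IsNil J) (X : J) : ((oneAdd hJ X : Rˣ) : R) = 1 + X := rfl

theorem coe_gElt (g : algGroup F R J) : (gElt g : R) = ((g : Rˣ) : R) - 1 := rfl

theorem coe_eq_one_add (g : algGroup F R J) : ((g : Rˣ) : R) = 1 + gElt g := by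
  rw [coe_gElt]; abel

/-- The bijection `g ↦ g - 1` from an algebra group to its algebra. -/
def gEquiv (hJ : IsNil J) : algGroup F R J ≃ J where
  toFun := gElt
  invFun := oneAdd hJ
  left_inv g := by
    apply Subtype.ext
    apply Units.ext
    rw [coe_oneAdd, coe_eq_one_add]
  right_inv X := by
    apply Subtype.ext
    rw [coe_gElt, coe_oneAdd, add_sub_cancel_left]

theorem gElt_oneAdd (hJ : IsNil J) (X : J) : gElt (oneAdd hJ X) = X :=
  (gEquiv hJ).apply_symm_apply X

theorem lmulMap_apply (g : algGroup F R J) (X : J) : lmulMap g X = X + gElt g * X := by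
  apply Subtype.ext
  change ((g : Rˣ) : R) * (X : R) = _
  rw [coe_eq_one_add]
  push_cast
  noncomm_ring

theorem rmulMap_apply (g : algGroup F R J) (X : J) : rmulMap g X = X + X * gElt g := by
  apply Subtype.ext
  change (X : R) * ((g : Rˣ) : R) = _
  rw [coe_eq_one_add]
  push_cast
  noncomm_ring

theorem coe_lmulMap (g : algGroup F R J) (X : J) : (lmulMap g X : R) = ((g : Rˣ) : R) * X := rfl

theorem coe_rmulMap (g : algGroup F R J) (X : J) : (rmulMap g X : R) = X * ((g : Rˣ) : R) := rfl

theorem lmulMap_mul (g h : algGroup F R J) (X : J) :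
    lmulMap (g * h) X = lmulMap g (lmulMap h X) := by
  apply Subtype.ext
  simp only [coe_lmulMap, Subgroup.coe_mul, Units.val_mul, mul_assoc]

theorem rmulMap_mul (g h : algGroup F R J) (X : J) :
    rmulMap (g * h) X = rmulMap h (rmulMap g X) := by
  apply Subtype.ext
  simp only [coe_rmulMap, Subgroup.coe_mul, Units.val_mul, mul_assoc]

theorem lmulMap_rmulMap (g h : algGroup F R J) (X : J) :
    lmulMap g (rmulMap h X) = rmulMap h (lmulMap g X) := by
  apply Subtype.ext
  simp only [coe_rmulMap, coe_lmulMap, mul_assoc]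

theorem leftAct_one (lam : J →ₗ[F] F) : leftAct 1 lam = lam := by
  ext X
  change lam (lmulMap 1⁻¹ X) = lam X
  congr 1
  apply Subtype.ext
  simp [coe_lmulMap]

theorem leftAct_mul (g h : algGroup F R J) (lam : J →ₗ[F] F) :
    leftAct (g * h) lam = leftAct g (leftAct h lam) := by
  ext X
  change lam (lmulMap (g * h)⁻¹ X) = lam (lmulMap h⁻¹ (lmulMap g⁻¹ X))
  rw [mul_inv_rev, lmulMap_mul]

theorem rightAct_mul (g h : algGroup F R J) (lam : J →ₗ[F] F) :
    rightAct (g * h) lam = rightAct h (rightAct g lam) := by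
  ext X
  change lam (rmulMap (g * h)⁻¹ X) = lam (rmulMap g⁻¹ (rmulMap h⁻¹ X))
  rw [mul_inv_rev, rmulMap_mul]

theorem leftAct_rightAct (g h : algGroup F R J) (lam : J →ₗ[F] F) :
    leftAct g (rightAct h lam) = rightAct h (leftAct g lam) := by
  ext X
  change lam (rmulMap h⁻¹ (lmulMap g⁻¹ X)) = lam (lmulMap g⁻¹ (rmulMap h⁻¹ X))
  rw [lmulMap_rmulMap]

/-! ### The subalgebras `𝔩_λ` and `𝔰_λ` as annihilators -/

theorem lamE_coe (lam : J →ₗ[F] F) (X : J) : lamE J lam X = lam X := lamE_apply J lam X.2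

theorem coe_mem_lone {lam : J →ₗ[F] F} {X : J} :
    (X : R) ∈ lone J lam ↔ ∀ Y : J, lam (X * Y) = 0 := by
  constructor
  · intro h Y
    rw [← lamE_coe]
    exact h.2 Y Y.2
  · intro h
    refine ⟨X.2, fun y hy => ?_⟩
    have := h ⟨y, hy⟩
    rwa [← lamE_coe] at this

theorem coe_mem_sone {lam : J →ₗ[F] F} {X : J} :
    (X : R) ∈ sone J lam ↔ ∀ Y : J, (Y : R) ∈ lone J lam → lam (X * Y) = 0 := by
  constructor
  · intro h Y hY
    rw [← lamE_coe]
    exact h.2 Y hY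
  · intro h
    refine ⟨X.2, fun y hy => ?_⟩
    have := h ⟨y, lone_le J lam hy⟩ hy
    rwa [← lamE_coe] at this

theorem lone_le_sone (lam : J →ₗ[F] F) : lone J lam ≤ sone J lam := by
  intro x hx
  exact ⟨hx.1, fun y hy => hx.2 y (lone_le J lam hy)⟩

/-- A functional killing the left kernel of the pairing `(v, Y) ↦ λ(f(v) Y)` is represented by some
`Y`. -/
theorem exists_eq_lam_mul (lam : J →ₗ[F] F) {V : Type} [AddCommGroup V] [Module F V]
    (f : V →ₗ[F] J) (g : V →ₗ[F] F) (hg : ∀ v, (f v : R) ∈ lone J lam → g v = 0) :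
    ∃ Y : J, ∀ v, g v = lam (f v * Y) := by
  let B : V →ₗ[F] Module.Dual F J := ((LinearMap.mul F J).compr₂ lam).comp f
  have hmem : g ∈ (LinearMap.ker B).dualAnnihilator := by
    rw [Submodule.mem_dualAnnihilator]
    intro v hv
    exact hg v (coe_mem_lone.mpr fun Y => LinearMap.congr_fun (LinearMap.mem_ker.mp hv) Y)
  rw [← LinearMap.range_dualMap_eq_dualAnnihilator_ker] at hmem
  obtain ⟨φ, rfl⟩ := hmem
  obtain ⟨Y, rfl⟩ := (Module.evalEquiv F J).surjective φ
  exact ⟨Y, fun v => rfl⟩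

theorem leftAct_eq_self_iff {lam : J →ₗ[F] F} {g : algGroup F R J} :
    leftAct g lam = lam ↔ (g : Rˣ) ∈ algGroup F R (lone J lam) := by
  rw [← inv_mem_iff, mem_algGroup_iff]
  change _ ↔ (gElt g⁻¹ : R) ∈ lone J lam
  rw [coe_mem_lone, LinearMap.ext_iff]
  refine forall_congr' fun X => ?_
  change lam (lmulMap g⁻¹ X) = lam X ↔ _
  rw [lmulMap_apply, map_add, add_eq_left]

theorem leftAct_mem_rightOrbit_iff (hJ : IsNil J) {lam : J →ₗ[F] F} {g : algGroup F R J} :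
    leftAct g lam ∈ rightOrbit J lam ↔ (g : Rˣ) ∈ algGroup F R (sone J lam) := by
  rw [← inv_mem_iff, mem_algGroup_iff]
  change _ ↔ (gElt g⁻¹ : R) ∈ sone J lam
  have key (h : algGroup F R J) : rightAct h lam = leftAct g lam ↔
      ∀ X, lam (gElt g⁻¹ * X) = lam (X * gElt h⁻¹) := by
    rw [LinearMap.ext_iff]
    refine forall_congr' fun X => ?_
    change lam (rmulMap h⁻¹ X) = lam (lmulMap g⁻¹ X) ↔ _
    rw [lmulMap_apply, rmulMap_apply, map_add, map_add, add_right_inj, eq_comm]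
  constructor
  · rintro ⟨h, hh⟩
    refine coe_mem_sone.mpr fun X hX => ?_
    rw [(key h).mp hh]
    exact coe_mem_lone.mp hX _
  · intro hg
    obtain ⟨Y, hY⟩ := exists_eq_lam_mul lam LinearMap.id
      (lam.comp (LinearMap.mul F J (gElt g⁻¹))) fun X hX => coe_mem_sone.mp hg X hX
    refine ⟨(oneAdd hJ Y)⁻¹, (key _).mpr fun X => ?_⟩
    rw [inv_inv, gElt_oneAdd]
    exact hY X

theorem card_leftAct_eq_self (lam : J →ₗ[F] F) :
    Nat.card {g : algGroup F R J // leftAct g lam = leftAct 1 lam} = Nat.card (LgrpIn J lam) := by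
  have e1 := Nat.card_congr (Subgroup.subgroupOfEquivOfLe
    (algGroup_mono (lone_le J lam))).toEquiv
  have e2 := Nat.card_congr (Subgroup.subgroupOfEquivOfLe
    (algGroup_mono (lone_le_sone lam))).toEquiv
  rw [LgrpIn, e2, ← e1]
  exact Nat.card_congr (Equiv.subtypeEquivRight fun g => by
    rw [leftAct_one, leftAct_eq_self_iff, Subgroup.mem_subgroupOf])

theorem card_leftOrbit_mul (lam : J →ₗ[F] F) :
    (Nat.card (algGroup F R J) : ℂ) =
      Nat.card (LgrpIn J lam) * Nat.card (leftOrbit J lam) := by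
  rw [card_orbitMap (fun g : algGroup F R J => leftAct g lam)
    (fun c a a' h => by simp only [leftAct_mul, h]), card_leftAct_eq_self, leftOrbit]

theorem card_inter_mul (hJ : IsNil J) (lam : J →ₗ[F] F) :
    (Nat.card (algGroup F R (sone J lam)) : ℂ) =
      Nat.card (LgrpIn J lam) * Nat.card ↥(leftOrbit J lam ∩ rightOrbit J lam) := by
  have e1 := Nat.card_congr (Subgroup.subgroupOfEquivOfLe
    (algGroup_mono (sone_le J lam))).toEquiv
  rw [← card_leftAct_eq_self, leftOrbit, ← card_preimage_orbitMap
    (fun g : algGroup F R J => leftAct g lam) (fun c a a' h => by simp only [leftAct_mul, h]), ← e1]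
  congr 1
  exact Nat.card_congr (Equiv.subtypeEquivRight fun g => by
    rw [leftAct_mem_rightOrbit_iff hJ, Subgroup.mem_subgroupOf])

end AlgebraGroup

/-! ### The linear character of `S_λ` -/

section LinearCharacter

variable {J : NonUnitalSubalgebra F R} {lam : J →ₗ[F] F}

/-- The linear character `θ_λ` of `S_λ` when `λ` vanishes on `(𝔰_λ)²`. -/
def soneChar (θ : AddChar F ℂ) (lam : J →ₗ[F] F)
    (hsq : ∀ x ∈ sone J lam, ∀ y ∈ sone J lam, lamE J lam (x * y) = 0) :
    algGroup F R (sone J lam) →* ℂˣ :=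
  MonoidHom.toHomUnits
    { toFun := fun s => θ (lamE J lam (gElt s))
      map_one' := by
        have h : (gElt (1 : algGroup F R (sone J lam)) : R) = 0 := by simp [coe_gElt]
        rw [h, lamE_zero, AddChar.map_zero_eq_one]
      map_mul' := fun s t => by
        have h : (gElt (s * t) : R) = gElt s * gElt t + (gElt s + gElt t) := by
          simp only [coe_gElt, Subgroup.coe_mul, Units.val_mul]
          noncomm_ring
        have hs := sone_le J lam (gElt s).2
        have ht := sone_le J lam (gElt t).2
        rw [h, lamE_add J lam (mul_mem hs ht) (add_mem hs ht), hsq _ (gElt s).2 _ (gElt t).2,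
          zero_add, lamE_add J lam hs ht, AddChar.map_add_eq_mul] }

theorem soneChar_apply (θ : AddChar F ℂ)
    (hsq : ∀ x ∈ sone J lam, ∀ y ∈ sone J lam, lamE J lam (x * y) = 0)
    (s : algGroup F R (sone J lam)) :
    (soneChar θ lam hsq s : ℂ) = θ (lamE J lam (gElt s)) := rfl

/-- A functional on which a nontrivial additive character is trivial vanishes. -/
theorem eq_zero_of_forall_addChar {θ : AddChar F ℂ} (hθ : θ ≠ 1) {a : F}
    (h : ∀ c : F, θ (c * a) = 1) : a = 0 := by
  by_contra ha
  refine hθ (DFunLike.ext _ _ fun x => ?_)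
  rw [← div_mul_cancel₀ x ha, h, AddChar.one_apply]

/-- The inclusion of `S_λ` in `G`. -/
def soneIncl (lam : J →ₗ[F] F) : algGroup F R (sone J lam) →* algGroup F R J :=
  Subgroup.inclusion (algGroup_mono (sone_le J lam))

theorem coe_soneIncl (s : algGroup F R (sone J lam)) : (soneIncl lam s : Rˣ) = s := rfl

theorem mem_LgrpIn {s : algGroup F R (sone J lam)} :
    s ∈ LgrpIn J lam ↔ (gElt s : R) ∈ lone J lam := by
  rw [LgrpIn, Subgroup.mem_subgroupOf, mem_algGroup_iff, coe_gElt]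

/-- Elements `Z` with `λ(ZX) = 0` whenever `X` and `ZX` lie in `𝔩_λ` belong to `𝔰_λ`. -/
theorem coe_mem_sone_of_forall (hJ : IsNil J) {Z : J}
    (hZ : ∀ X : J, (X : R) ∈ lone J lam → ((Z * X : J) : R) ∈ lone J lam → lam (Z * X) = 0) :
    (Z : R) ∈ sone J lam := by
  let f : lone J lam →ₗ[F] J := (LinearMap.mul F J Z).comp (inclMap (lone_le J lam))
  obtain ⟨Y, hY⟩ := exists_eq_lam_mul lam f (lam.comp f) fun X hX => hZ _ X.2 hX
  refine coe_mem_sone.mpr fun X hX => ?_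
  set v := (oneAdd hJ (-Y))⁻¹
  have hv : (rmulMap v X : R) ∈ lone J lam := by
    rw [rmulMap_apply]
    exact add_mem hX (lone_mul_mem J lam hX (gElt v).2)
  have h1 : lam (Z * rmulMap v X) = lam (Z * rmulMap v X * Y) := hY ⟨_, hv⟩
  have h2 : Z * X = Z * rmulMap v X - Z * rmulMap v X * Y := by
    have h3 : rmulMap v⁻¹ (rmulMap v X) = X := by
      rw [← rmulMap_mul, mul_inv_cancel]
      exact Subtype.ext (by simp [coe_rmulMap])
    rw [mul_assoc, ← mul_sub]
    congr 1
    conv_lhs => rw [← h3, rmulMap_apply, inv_inv, gElt_oneAdd]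
    rw [sub_eq_add_neg]
    congr 1
    exact Subtype.ext (by simp)
  rw [h2, map_sub, ← h1, sub_self]

theorem exists_conj_soneChar_ne (hJ : IsNil J) {θ : AddChar F ℂ} (hθ : θ ≠ 1)
    (hsq : ∀ x ∈ sone J lam, ∀ y ∈ sone J lam, lamE J lam (x * y) = 0)
    {g : algGroup F R J} (hg : g ∉ (soneIncl lam).range) :
    ∃ l ∈ LgrpIn J lam, ∃ l' ∈ LgrpIn J lam, soneIncl lam l' = g * soneIncl lam l * g⁻¹ ∧
      soneChar θ lam hsq l ≠ soneChar θ lam hsq l' := by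
  by_contra! hcon
  refine hg ?_
  suffices h : (gElt g : R) ∈ sone J lam from
    ⟨⟨g, mem_algGroup_iff.mpr h⟩, rfl⟩
  refine coe_mem_sone_of_forall hJ fun X hX hgX => eq_zero_of_forall_addChar hθ fun c => ?_
  have hcX : ((c • X : J) : R) ∈ lone J lam := SMulMemClass.smul_mem c hX
  have hgcX : (lmulMap g (c • X) : R) ∈ lone J lam := by
    rw [lmulMap_apply, mul_smul_comm]
    exact add_mem hcX (SMulMemClass.smul_mem c hgX)
  have hconj : (rmulMap g⁻¹ (lmulMap g (c • X)) : R) ∈ lone J lam := by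
    rw [rmulMap_apply]
    exact add_mem hgcX (lone_mul_mem J lam hgcX (gElt g⁻¹).2)
  have hS (Y : J) (hY : (Y : R) ∈ lone J lam) :
      ((oneAdd hJ Y : algGroup F R J) : Rˣ) ∈ algGroup F R (sone J lam) := by
    rw [mem_algGroup_iff, coe_oneAdd, add_sub_cancel_left]
    exact lone_le_sone lam hY
  have hL (Y : J) (hY : (Y : R) ∈ lone J lam) :
      (⟨_, hS Y hY⟩ : algGroup F R (sone J lam)) ∈ LgrpIn J lam := by
    rw [mem_LgrpIn, coe_gElt, coe_oneAdd, add_sub_cancel_left]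
    exact hY
  have h := hcon _ (hL _ hcX) _ (hL _ hconj) (by
    apply Subtype.ext
    apply Units.ext
    simp only [coe_soneIncl, Subgroup.coe_mul, Units.val_mul, coe_oneAdd, coe_rmulMap, coe_lmulMap]
    rw [mul_add, add_mul, mul_one, ← Units.val_mul, ← Subgroup.coe_mul, mul_inv_cancel]
    rfl)
  have h' := congrArg (Units.val) h
  simp only [soneChar_apply, coe_gElt, coe_oneAdd, add_sub_cancel_left, lamE_coe] at h'
  rw [rmulMap_apply g⁻¹, map_add, coe_mem_lone.mp hgcX, add_zero, lmulMap_apply, map_add,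
    AddChar.map_add_eq_mul, mul_smul_comm, map_smul, smul_eq_mul] at h'
  rw [map_smul, smul_eq_mul] at h'
  have hne : θ (c * lam X) ≠ 0 := (θ.val_isUnit _).ne_zero
  exact mul_left_cancel₀ hne (by rw [← h', mul_one])

end LinearCharacter

/-! ### Inner products with supercharacters -/

section Supercharacter

variable {J : NonUnitalSubalgebra F R}

theorem superchar_apply (θ : AddChar F ℂ) (lam : J →ₗ[F] F) (x : algGroup F R J) :
    superchar θ J lam x = (Nat.card (leftOrbit J lam) : ℂ) * (Nat.card (algGroup F R J) : ℂ)⁻¹ ^ 2 *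
      ∑ g : algGroup F R J, ∑ h : algGroup F R J,
        θ (lam (lmulMap g⁻¹ (rmulMap h (gElt x)))) := by
  let p : algGroup F R J × algGroup F R J → J →ₗ[F] F :=
    fun a => leftAct a.1 (rightAct a.2⁻¹ lam)
  have hp : ∀ c a a', p a = p a' → p (c * a) = p (c * a') := by
    intro c a a' h
    have key (b) : p (c * b) = leftAct c.1 (rightAct c.2⁻¹ (p b)) := by
      simp only [p, Prod.fst_mul, Prod.snd_mul, mul_inv_rev, leftAct_mul, rightAct_mul,
        leftAct_rightAct]
    rw [key, key, h]
  have hrange : twoOrbit J lam = Set.range p := by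
    ext mu
    constructor
    · rintro ⟨g, h, rfl⟩
      exact ⟨(g, h⁻¹), by simp [p]⟩
    · rintro ⟨⟨g, h⟩, rfl⟩
      exact ⟨g, h⁻¹, rfl⟩
  have hsum := sum_orbitMap_eq_finsum p hp (fun mu => thetaFn θ J mu x)
  have hcard := card_orbitMap p hp
  have h0 : (Nat.card (algGroup F R J) : ℂ) ≠ 0 := Nat.cast_ne_zero.mpr Nat.card_pos.ne'
  rw [Nat.card_prod, Nat.cast_mul] at hcard
  have hprod := mul_ne_zero h0 h0
  rw [hcard] at hprod
  have hT := right_ne_zero_of_mul hprod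
  have hK := left_ne_zero_of_mul hprod
  rw [Fintype.sum_prod_type] at hsum
  have hterm : ∑ g : algGroup F R J, ∑ h : algGroup F R J,
        θ (lam (lmulMap g⁻¹ (rmulMap h (gElt x)))) =
      ∑ g : algGroup F R J, ∑ h : algGroup F R J, thetaFn θ J (p (g, h)) x := by
    refine Finset.sum_congr rfl fun g _ => Finset.sum_congr rfl fun h _ => ?_
    change _ = θ (lam (rmulMap h⁻¹⁻¹ (lmulMap g⁻¹ (gElt x))))
    rw [inv_inv, lmulMap_rmulMap]
  rw [superchar, hterm, hsum, inv_pow, pow_two, hcard, ← hrange]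
  rw [← hrange] at hT
  field_simp

theorem sum_theta_rmulMap (hJ : IsNil J) {θ : AddChar F ℂ} (hθ : θ ≠ 1) (lam : J →ₗ[F] F) (X : J) :
    ∑ h : algGroup F R J, θ (lam (rmulMap h X)) =
      if (X : R) ∈ lone J lam then (Nat.card (algGroup F R J) : ℂ) * θ (lam X) else 0 := by
  let χ : AddChar J ℂ := θ.compAddMonoidHom (lam.toAddMonoidHom.comp (AddMonoidHom.mulLeft X))
  have hχ (Y : J) : χ Y = θ (lam (X * Y)) := rfl
  have h1 : ∑ h : algGroup F R J, θ (lam (rmulMap h X)) = θ (lam X) * ∑ Y : J, χ Y := by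
    rw [← (gEquiv hJ).sum_comp, Finset.mul_sum]
    refine Finset.sum_congr rfl fun h _ => ?_
    rw [rmulMap_apply, map_add, AddChar.map_add_eq_mul]
    rfl
  have h2 : χ = 0 ↔ (X : R) ∈ lone J lam := by
    rw [coe_mem_lone]
    constructor
    · intro h Y
      refine eq_zero_of_forall_addChar hθ fun c => ?_
      rw [← smul_eq_mul, ← map_smul, ← mul_smul_comm, ← hχ, h, AddChar.zero_apply]
    · intro h
      ext Y
      rw [hχ, h, AddChar.map_zero_eq_one, AddChar.zero_apply]
  rw [h1, AddChar.sum_eq_ite, Nat.card_congr (gEquiv hJ), Nat.card_eq_fintype_card]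
  by_cases h : (X : R) ∈ lone J lam
  · rw [if_pos h, if_pos (h2.mpr h), mul_comm]
  · rw [if_neg h, if_neg (mt h2.mp h), mul_zero]

theorem gElt_conj (g x : algGroup F R J) :
    gElt (g * x * g⁻¹) = lmulMap g (rmulMap g⁻¹ (gElt x)) := by
  apply Subtype.ext
  simp only [coe_lmulMap, coe_rmulMap, coe_gElt, Subgroup.coe_mul, Units.val_mul]
  have h : ((g : Rˣ) : R) * ((g⁻¹ : algGroup F R J) : Rˣ) = 1 := Units.mul_inv _
  rw [sub_mul, mul_sub, one_mul, h, mul_assoc]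

theorem innerG_superchar (hJ : IsNil J) {θ : AddChar F ℂ} (hθ : θ ≠ 1) (lam : J →ₗ[F] F)
    {ψ : algGroup F R J → ℂ} (hψ : IsCharacter _ ψ) :
    innerG _ (superchar θ J lam) ψ = (Nat.card (LgrpIn J lam) : ℂ)⁻¹ *
      ∑ x : algGroup F R J, if (gElt x : R) ∈ lone J lam then
        θ (lam (gElt x)) * (starRingEnd ℂ) (ψ x) else 0 := by
  have h0 : (Nat.card (algGroup F R J) : ℂ) ≠ 0 := Nat.cast_ne_zero.mpr Nat.card_pos.ne'
  have hL : (Nat.card (LgrpIn J lam) : ℂ) ≠ 0 := Nat.cast_ne_zero.mpr Nat.card_pos.ne'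
  have hc := card_leftOrbit_mul lam
  have hg (g : algGroup F R J) :
      ∑ x : algGroup F R J, (∑ h : algGroup F R J,
        θ (lam (lmulMap g⁻¹ (rmulMap h (gElt x))))) * (starRingEnd ℂ) (ψ x) =
      (Nat.card (algGroup F R J) : ℂ) * ∑ x : algGroup F R J,
        if (gElt x : R) ∈ lone J lam then
          θ (lam (gElt x)) * (starRingEnd ℂ) (ψ x) else 0 := by
    rw [← (MulAut.conj g).toEquiv.sum_comp, Finset.mul_sum]
    refine Finset.sum_congr rfl fun x _ => ?_
    have hx : (MulAut.conj g).toEquiv x = g * x * g⁻¹ := rfl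
    rw [hx, hψ.map_conj, ← Equiv.sum_comp (Equiv.mulLeft g)]
    have hin (h : algGroup F R J) : lmulMap g⁻¹ (rmulMap (g * h) (gElt (g * x * g⁻¹))) =
        rmulMap h (gElt x) := by
      rw [gElt_conj, ← lmulMap_rmulMap, ← lmulMap_mul, inv_mul_cancel, ← rmulMap_mul,
        inv_mul_cancel_left]
      exact Subtype.ext (by simp [coe_lmulMap])
    simp only [Equiv.coe_mulLeft, hin]
    rw [sum_theta_rmulMap hJ hθ]
    split_ifs <;> ring
  rw [innerG_eq_sum]
  simp only [superchar_apply, mul_assoc, ← Finset.mul_sum]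
  simp only [Finset.sum_mul (s := Finset.univ)] at hg ⊢
  rw [Finset.sum_comm]
  simp only [hg, Finset.sum_const, Finset.card_univ, nsmul_eq_mul, ← Nat.card_eq_fintype_card]
  generalize (∑ x : algGroup F R J, _ : ℂ) = T
  have hO : (Nat.card (leftOrbit J lam) : ℂ) =
      Nat.card (algGroup F R J) * (Nat.card (LgrpIn J lam) : ℂ)⁻¹ := by
    rw [hc]; field_simp
  rw [hO]
  field_simp

theorem innerG_superchar_eq_twistRes (hJ : IsNil J) {θ : AddChar F ℂ} (hθ : θ ≠ 1)
    (lam : J →ₗ[F] F)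
    (hsq : ∀ x ∈ sone J lam, ∀ y ∈ sone J lam, lamE J lam (x * y) = 0)
    {ψ : algGroup F R J → ℂ} (hψ : IsCharacter _ ψ) :
    innerG _ (superchar θ J lam) ψ =
      (starRingEnd ℂ) (twistRes (soneIncl lam) (LgrpIn J lam) (soneChar θ lam hsq) ψ 1) := by
  rw [innerG_superchar hJ hθ lam hψ, twistRes, map_mul, map_inv₀, map_natCast, map_sum]
  congr 1
  symm
  refine Finset.sum_of_injOn (soneIncl lam) ?_ (by simp) ?_ ?_
  · exact (Subgroup.inclusion_injective _).injOn
  · intro x _ hx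
    rw [if_neg]
    intro h
    refine hx ⟨⟨x, mem_algGroup_iff.mpr (lone_le_sone lam h)⟩, by simp, rfl⟩
  · intro s _
    have hs : (gElt (soneIncl lam s) : R) = gElt s := rfl
    simp only [hs, ← mem_LgrpIn, QuotientGroup.eq_one_iff]
    split_ifs
    · rw [map_mul, star_linear, soneChar_apply, ← hs, lamE_coe]
    · rw [map_zero]

end Supercharacter

theorem statement4 (F : Type) [Field F] [Fintype F]
    (R : Type) [Ring R] [Algebra F R] [Fintype R]
    (J : NonUnitalSubalgebra F R) (hJ : IsNil J)
    (θ : AddChar F ℂ) (hθ : θ ≠ 1)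
    (lam : ↥J →ₗ[F] F)
    (hsq : ∀ x ∈ sone J lam, ∀ y ∈ sone J lam, lamE J lam (x * y) = 0) (e : ℕ) :
    Nat.card ↥{ψ | ψ ∈ IrrConstituents ↥(algGroup F R J) (superchar θ J lam) ∧
        ψ 1 = (Fintype.card F : ℂ) ^ e} =
      Nat.card ↥{ψ : (↥(algGroup F R (sone J lam)) ⧸ LgrpIn J lam) → ℂ |
        ψ ∈ Irr (↥(algGroup F R (sone J lam)) ⧸ LgrpIn J lam) ∧
        ψ 1 = ((Nat.card ↥(leftOrbit J lam ∩ rightOrbit J lam) : ℂ) /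
            (Nat.card ↥(leftOrbit J lam) : ℂ)) * (Fintype.card F : ℂ) ^ e} := by
  have hratio : (Nat.card ↥(leftOrbit J lam ∩ rightOrbit J lam) : ℂ) /
      (Nat.card ↥(leftOrbit J lam) : ℂ) =
      (Nat.card (algGroup F R (sone J lam)) : ℂ) / Nat.card (algGroup F R J) := by
    have hL : (Nat.card (LgrpIn J lam) : ℂ) ≠ 0 := Nat.cast_ne_zero.mpr Nat.card_pos.ne'
    rw [card_inter_mul hJ lam, card_leftOrbit_mul lam, mul_div_mul_left _ _ hL]
  rw [hratio]
  exact card_constituents_eq (Subgroup.inclusion_injective (algGroup_mono (sone_le J lam)))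
    (fun g hg => exists_conj_soneChar_ne hJ hθ hsq hg)
    (fun ψ hψ => innerG_superchar_eq_twistRes hJ hθ lam hsq hψ) _

end IterChar
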